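/- arXiv:1311.0028 — 2 statements merged into one kernel-verified Lean document; each statement's English description precedes it below -/
import Mathlib

section
/- Local uniform equivalence of LGL grids of comparable order: for every constant c with 0 < c ≤ 1, there exist constants A and B with 0 < A ≤ B, depending only on c, such that for all integers M, N with 1 ≤ M, c·N ≤ M ≤ N, and all integers k, ℓ with 0 ≤ k ≤ N−1 and 0 ≤ ℓ ≤ M−1, if Δ_k^N ∩ Δ_ℓ^M ≠ ∅ then A ≤ |Δ_k^N|/|Δ_ℓ^M| ≤ B. -/
/-- The Legendre polynomial of degree `N` via the Rodrigues formula. -/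
noncomputable def legendrePoly (N : ℕ) : Polynomial ℝ :=
  Polynomial.C (1 / (2 ^ N * N.factorial : ℝ)) *
    Polynomial.derivative^[N] ((Polynomial.X ^ 2 - 1) ^ N)

/-- The polynomial `(1 - x²)·L_N'(x)` whose zeros are the LGL nodes of order `N`. -/
noncomputable def lglPoly (N : ℕ) : Polynomial ℝ :=
  (1 - Polynomial.X ^ 2) * Polynomial.derivative (legendrePoly N)

/-- `ξ 0 < ξ 1 < ⋯ < ξ N` enumerates the Legendre-Gauss-Lobatto nodes of order `N`
in increasing order. -/
def IsLGLNodes (N : ℕ) (ξ : ℕ → ℝ) : Prop :=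
  StrictMonoOn ξ (Set.Iic N) ∧ ξ 0 = -1 ∧ ξ N = 1 ∧
    (∀ k ≤ N, (lglPoly N).eval (ξ k) = 0) ∧
    (∀ x : ℝ, (lglPoly N).eval x = 0 → ∃ k ≤ N, ξ k = x)

open Polynomial in
/-- The Legendre equation in the form `((1 - x²) L_N')' = -N (N + 1) L_N`. -/
theorem derivative_lglPoly (N : ℕ) :
    derivative (lglPoly N) = -C ((N : ℝ) * (N + 1)) * legendrePoly N := by
  set v : ℝ[X] := (X ^ 2 - 1) ^ N with hv
  have h0 : derivative v * X * X - derivative v = C (2 * N : ℝ) * (v * X) := by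
    rcases N with _ | n
    · simp [hv]
    · simp only [hv, derivative_pow_succ, derivative_sub, derivative_X, derivative_one]
      simp only [map_mul, map_add, map_natCast, map_one, Nat.cast_add, Nat.cast_one, map_ofNat]
      ring
  have h1 := congrArg (fun p => derivative^[N + 1] p) h0
  simp only [iterate_derivative_sub, iterate_derivative_C_mul,
    iterate_derivative_mul_X (derivative v * X), iterate_derivative_derivative_mul_X,
    iterate_derivative_mul_X v, Nat.add_sub_cancel] at h1
  set w := derivative^[N] v with hw
  have e1 : derivative^[N + 1] v = derivative w := Function.iterate_succ_apply' _ _ _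
  have e2 : derivative^[N + 1 + 1] v = derivative (derivative w) := by
    rw [Function.iterate_succ_apply', e1]
  have e3 : derivative^[N + 1] (derivative v) = derivative (derivative w) := e2
  rw [e3, e2, e1] at h1
  rw [lglPoly, legendrePoly, ← hv, ← hw]
  simp only [derivative_mul, derivative_C, zero_mul, zero_add, derivative_sub, derivative_X_sq,
    derivative_one, zero_sub]
  simp only [nsmul_eq_mul, map_mul, map_add, map_natCast, map_one, Nat.cast_add, Nat.cast_one,
    map_ofNat] at h1 ⊢
  linear_combination (-C (1 / (2 ^ N * N.factorial : ℝ))) * h1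

open Polynomial in
theorem lglPoly_ode (N : ℕ) :
    (1 - X ^ 2) * derivative (derivative (lglPoly N))
      = -C ((N : ℝ) * (N + 1)) * lglPoly N := by
  rw [derivative_lglPoly]
  simp only [derivative_mul, derivative_neg, derivative_C, neg_zero, zero_mul, zero_add]
  rw [lglPoly]
  ring

section Sturm

open Polynomial Set

variable {p : ℝ[X]} {lam a b : ℝ}

theorem eval_ode (hode : (1 - X ^ 2) * derivative (derivative p) = -C lam * p) (x : ℝ) :
    (1 - x ^ 2) * (derivative (derivative p)).eval x = -lam * p.eval x := by
  simpa using congrArg (eval x) hode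

/-- A positive solution vanishing at `a` with a critical point at `z` needs room between them. -/
theorem exists_le_of_critical (hlam : 0 < lam)
    (hode : (1 - X ^ 2) * derivative (derivative p) = -C lam * p)
    {z : ℝ} (haz : a < z) (ha : -1 ≤ a) (hz : z < 1) (hpa : p.eval a = 0)
    (hpz : (derivative p).eval z = 0) (hpos : ∀ x ∈ Ioo a z, 0 < p.eval x) :
    ∃ t ∈ Ioo a z, 1 - t ^ 2 ≤ lam * (z - a) * (t - a) := by
  have hq : ∀ x ∈ Ioo a z, 0 < 1 - x ^ 2 := fun x hx => by nlinarith [hx.1, hx.2]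
  have hneg : ∀ x ∈ Ioo a z, (derivative (derivative p)).eval x < 0 := fun x hx => by
    have h := eval_ode hode x
    have := mul_pos hlam (hpos x hx)
    by_contra! hc
    nlinarith [mul_nonneg (hq x hx).le hc]
  have hanti : AntitoneOn (fun x => (derivative p).eval x) (Icc a z) := by
    refine antitoneOn_of_deriv_nonpos (convex_Icc a z) (derivative p).continuousOn
      (derivative p).differentiableOn fun x hx => ?_
    rw [interior_Icc] at hx
    simpa using (hneg x hx).le
  have hbound : ∀ t ∈ Ioo a z, p.eval t ≤ (derivative p).eval a * (t - a) := fun t ht => by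
    obtain ⟨s, hs, h⟩ := exists_hasDerivAt_eq_slope (fun x => p.eval x) _ ht.1 p.continuousOn
      fun x _ => p.hasDerivAt x
    rw [eq_div_iff (sub_pos.2 ht.1).ne', hpa, sub_zero] at h
    rw [← h]
    exact mul_le_mul_of_nonneg_right
      (hanti ⟨le_rfl, haz.le⟩ ⟨hs.1.le, hs.2.le.trans ht.2.le⟩ hs.1.le) (sub_pos.2 ht.1).le
  obtain ⟨t, ht, h⟩ := exists_hasDerivAt_eq_slope (fun x => (derivative p).eval x) _ haz
    (derivative p).continuousOn fun x _ => (derivative p).hasDerivAt x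
  rw [eq_div_iff (sub_pos.2 haz).ne', hpz, zero_sub] at h
  refine ⟨t, ht, ?_⟩
  have hd : 0 < (derivative p).eval a :=
    pos_of_mul_pos_left ((hpos t ht).trans_le (hbound t ht)) (sub_pos.2 ht.1).le
  have key : (derivative p).eval a * (1 - t ^ 2) = lam * (z - a) * p.eval t := by
    linear_combination (z - a) * (-eval_ode hode t) + (1 - t ^ 2) * h
  have h3 := mul_le_mul_of_nonneg_left (hbound t ht) (mul_pos hlam (sub_pos.2 haz)).le
  refine le_of_mul_le_mul_left ?_ hd
  nlinarith

theorem gap_lower (hlam : 0 < lam)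
    (hode : (1 - X ^ 2) * derivative (derivative p) = -C lam * p)
    (hab : a < b) (ha : -1 ≤ a) (hb : b ≤ 1) (hpa : p.eval a = 0) (hpb : p.eval b = 0)
    (hpos : ∀ x ∈ Ioo a b, 0 < p.eval x) :
    1 ≤ 2 * lam * (b - a) ∧ ∀ y ∈ Icc a b, 1 - y ^ 2 ≤ lam * (b - a) ^ 2 + 2 * (b - a) := by
  obtain ⟨z, hz, hpz⟩ := exists_hasDerivAt_eq_zero (f := fun x => p.eval x) hab p.continuousOn
    (by simp [hpa, hpb]) fun x _ => p.hasDerivAt x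
  obtain ⟨t, ht, h1⟩ := exists_le_of_critical hlam hode hz.1 ha (hz.2.trans_le hb) hpa hpz
    fun x hx => hpos x ⟨hx.1, hx.2.trans hz.2⟩
  obtain ⟨s, hs, h2⟩ := exists_le_of_critical (p := p.comp (-X)) (a := -b) (z := -z) hlam
    (by
      have h := congrArg (fun q => q.comp (-X)) hode
      simpa [derivative_comp] using h)
    (neg_lt_neg hz.2) (neg_le_neg hb) (by linarith [hz.1]) (by simpa using hpb)
    (by simpa [derivative_comp] using hpz)
    (fun x hx => by
      simpa using hpos (-x) ⟨by linarith [hx.2, hz.1], by linarith [hx.1]⟩)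
  obtain ⟨hz1, hz2⟩ := hz
  obtain ⟨ht1, ht2⟩ := ht
  obtain ⟨hs1, hs2⟩ := hs
  constructor
  · rcases le_total z 0 with h0 | h0
    · have h3 : lam * (z - a) * (t - a) ≤ lam * (b - a) * (1 + t) := by gcongr; linarith
      have h4 : (1 - t) * (1 + t) ≤ lam * (b - a) * (1 + t) := by nlinarith
      have := le_of_mul_le_mul_right h4 (by linarith)
      nlinarith [mul_pos hlam (sub_pos.2 hab)]
    · have h3 : lam * (b - z) * (b + s) ≤ lam * (b - a) * (1 + s) := by
        gcongr; linarith
      have h4 : (1 - s) * (1 + s) ≤ lam * (b - a) * (1 + s) := by nlinarith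
      have := le_of_mul_le_mul_right h4 (by linarith)
      nlinarith [mul_pos hlam (sub_pos.2 hab)]
  · rintro y ⟨hy1, hy2⟩
    have h3 : lam * (z - a) * (t - a) ≤ lam * (b - a) * (b - a) := by gcongr; linarith
    have h4 : t ^ 2 - y ^ 2 ≤ 2 * (b - a) := by
      rcases le_total y t with h | h
      · nlinarith [mul_nonneg (sub_nonneg.2 h) (by linarith : (0:ℝ) ≤ 2 - (t + y))]
      · nlinarith [mul_nonneg (sub_nonneg.2 h) (by linarith : (0:ℝ) ≤ 2 + (t + y))]
    nlinarith

/-- Sturm comparison with the sine of frequency `μ`. -/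
theorem gap_le_pi_div
    (hode : (1 - X ^ 2) * derivative (derivative p) = -C lam * p)
    (ha : -1 ≤ a) (hb : b ≤ 1) (hpa : p.eval a = 0)
    (hpos : ∀ x ∈ Ioo a b, 0 < p.eval x) {μ : ℝ} (hμ : 0 < μ)
    (hq : ∀ x ∈ Ioo a b, μ ^ 2 * (1 - x ^ 2) ≤ lam) : b - a ≤ Real.pi / μ := by
  by_contra! hlt
  set e := a + Real.pi / μ with he
  have hae : a < e := by have := div_pos Real.pi_pos hμ; linarith
  have heb : e < b := by linarith
  have hμe : μ * (e - a) = Real.pi := by rw [he]; field_simp; ring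
  set W : ℝ → ℝ := fun x => (derivative p).eval x * Real.sin (μ * (x - a))
    - p.eval x * (Real.cos (μ * (x - a)) * μ) with hW
  have hs : ∀ x, HasDerivAt (fun x => μ * (x - a)) μ x := fun x => by
    simpa using ((hasDerivAt_id x).sub_const a).const_mul μ
  have hd : ∀ x, HasDerivAt W (((derivative (derivative p)).eval x + μ ^ 2 * p.eval x)
      * Real.sin (μ * (x - a))) x := fun x => by
    have h := (((derivative p).hasDerivAt x).mul (hs x).sin).sub
      ((p.hasDerivAt x).mul ((hs x).cos.mul_const μ))
    refine h.congr_deriv ?_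
    ring
  have hanti : AntitoneOn W (Icc a e) := by
    refine antitoneOn_of_deriv_nonpos (convex_Icc a e)
      (fun x _ => (hd x).continuousAt.continuousWithinAt)
      (fun x _ => (hd x).differentiableAt.differentiableWithinAt) fun x hx => ?_
    rw [interior_Icc] at hx
    rw [(hd x).deriv]
    have hxb : x ∈ Ioo a b := ⟨hx.1, hx.2.trans heb⟩
    have hD : 0 < 1 - x ^ 2 := by nlinarith [hxb.1, hxb.2]
    refine mul_nonpos_of_nonpos_of_nonneg ?_ (Real.sin_nonneg_of_nonneg_of_le_pi
      (mul_nonneg hμ.le (sub_pos.2 hx.1).le) ?_)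
    · have h1 := eval_ode hode x
      have h2 := mul_le_mul_of_nonneg_right (hq x hxb) (hpos x hxb).le
      refine nonpos_of_mul_nonpos_right (?_ : (1 - x ^ 2) * _ ≤ 0) hD
      nlinarith
    · rw [← hμe]
      gcongr
      exact hx.2.le
  have h := hanti ⟨le_rfl, hae.le⟩ ⟨hae.le, le_rfl⟩ hae.le
  simp only [hW, hμe, sub_self, mul_zero, Real.sin_zero, Real.sin_pi, Real.cos_pi, hpa] at h
  nlinarith [mul_pos (hpos e ⟨hae, heb⟩) hμ]

theorem gap_upper (hlam : 0 < lam)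
    (hode : (1 - X ^ 2) * derivative (derivative p) = -C lam * p)
    (hab : a < b) (ha : -1 ≤ a) (hb : b ≤ 1) (hpa : p.eval a = 0)
    (hpos : ∀ x ∈ Ioo a b, 0 < p.eval x) {y : ℝ} (hy : y ∈ Icc a b) :
    lam * (b - a) ^ 2 ≤ Real.pi ^ 2 * (1 - y ^ 2 + 2 * (b - a)) := by
  obtain ⟨hy1, hy2⟩ := hy
  set D := 1 - y ^ 2 + 2 * (b - a) with hD
  have hDpos : 0 < D := by nlinarith
  have hμ : 0 < √(lam / D) := Real.sqrt_pos.2 (div_pos hlam hDpos)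
  have hsq : √(lam / D) ^ 2 = lam / D := Real.sq_sqrt (div_pos hlam hDpos).le
  have h := gap_le_pi_div hode ha hb hpa hpos hμ fun x hx => by
    obtain ⟨hx1, hx2⟩ := hx
    have h4 : 1 - x ^ 2 ≤ D := by
      rcases le_total y x with h | h
      · nlinarith [mul_nonneg (sub_nonneg.2 h) (by linarith : (0:ℝ) ≤ 2 + (x + y))]
      · nlinarith [mul_nonneg (sub_nonneg.2 h) (by linarith : (0:ℝ) ≤ 2 - (x + y))]
    rw [hsq]
    calc lam / D * (1 - x ^ 2) ≤ lam / D * D := by gcongr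
      _ = lam := div_mul_cancel₀ _ hDpos.ne'
  rw [le_div_iff₀ hμ] at h
  have h2 := pow_le_pow_left₀ (mul_pos (sub_pos.2 hab) hμ).le h 2
  rw [mul_pow, hsq, mul_div_assoc', div_le_iff₀ hDpos] at h2
  linarith

/-- Two-sided estimate of the gap between consecutive zeros of a solution of
`(1 - x²) p'' = -lam p`. -/
theorem gap_bounds (hlam : 0 < lam)
    (hode : (1 - X ^ 2) * derivative (derivative p) = -C lam * p)
    (hab : a < b) (ha : -1 ≤ a) (hb : b ≤ 1) (hpa : p.eval a = 0) (hpb : p.eval b = 0)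
    (hne : ∀ x ∈ Ioo a b, p.eval x ≠ 0) {y : ℝ} (hy : y ∈ Icc a b) :
    (1 - y ^ 2) / lam + 1 / lam ^ 2 ≤ 9 * (b - a) ^ 2 ∧
      (b - a) ^ 2 ≤ 4 * Real.pi ^ 4 * ((1 - y ^ 2) / lam + 1 / lam ^ 2) := by
  wlog hpos : ∀ x ∈ Ioo a b, 0 < p.eval x generalizing p with H
  · refine H (p := -p) (by simp [hode]) (by simp [hpa]) (by simp [hpb])
      (fun x hx => by simpa using hne x hx) fun x hx => ?_
    push Not at hpos
    obtain ⟨w, hw, hpw⟩ := hpos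
    rw [eval_neg, neg_pos]
    by_contra! hx0
    obtain ⟨r, hr, hr0⟩ := isPreconnected_Ioo.intermediate_value hw hx p.continuousOn ⟨hpw, hx0⟩
    exact hne r hr hr0
  obtain ⟨h1, h2⟩ := gap_lower hlam hode hab ha hb hpa hpb hpos
  have h2 := h2 y hy
  have h3 := gap_upper hlam hode hab ha hb hpa hpos hy
  have hE : (1 - y ^ 2) / lam + 1 / lam ^ 2 = ((1 - y ^ 2) * lam + 1) / lam ^ 2 := by
    field_simp
  have hy0 : 0 ≤ 1 - y ^ 2 := by nlinarith [hy.1, hy.2]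
  have hlam2 : 0 < lam ^ 2 := by positivity
  set d := b - a
  have hd : 0 < d := sub_pos.2 hab
  rw [hE]
  constructor
  · rw [div_le_iff₀ hlam2]
    have h4 : d * lam ≤ 2 * lam * d * (d * lam) := le_mul_of_one_le_left (by positivity) h1
    have h5 : 1 ≤ (2 * lam * d) ^ 2 := one_le_pow₀ h1
    nlinarith [mul_le_mul_of_nonneg_right h2 hlam.le]
  · rw [mul_div_assoc', le_div_iff₀ hlam2]
    have hpi : 1 ≤ Real.pi ^ 2 := one_le_pow₀ (by linarith [Real.pi_gt_three])
    have h4 := mul_le_mul_of_nonneg_right h3 hlam.le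
    have h5 : Real.pi ^ 2 * ((1 - y ^ 2) * lam) ≤ Real.pi ^ 4 * ((1 - y ^ 2) * lam) := by
      gcongr
      · linarith [Real.pi_gt_three]
      · norm_num
    have h6 : 0 ≤ Real.pi ^ 4 * ((1 - y ^ 2) * lam) := by positivity
    nlinarith [sq_nonneg (d * lam - 2 * Real.pi ^ 2)]

end Sturm

theorem IsLGLNodes.gap_bounds {N : ℕ} {ξ : ℕ → ℝ} (hξ : IsLGLNodes N ξ) (hN : 1 ≤ N) {k : ℕ}
    (hk : k ≤ N - 1) :
    0 < ξ (k + 1) - ξ k ∧ ∀ y ∈ Set.Icc (ξ k) (ξ (k + 1)),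
      0 ≤ 1 - y ^ 2 ∧
      (1 - y ^ 2) / (N * (N + 1)) + 1 / (N * (N + 1) : ℝ) ^ 2 ≤ 9 * (ξ (k + 1) - ξ k) ^ 2 ∧
      (ξ (k + 1) - ξ k) ^ 2 ≤
        4 * Real.pi ^ 4 * ((1 - y ^ 2) / (N * (N + 1)) + 1 / (N * (N + 1) : ℝ) ^ 2) := by
  obtain ⟨hmono, h0, h1, hz, hall⟩ := hξ
  have hkN : k ∈ Set.Iic N := by simp only [Set.mem_Iic]; omega
  have hkN' : k + 1 ∈ Set.Iic N := by simp only [Set.mem_Iic]; omega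
  have hab : ξ k < ξ (k + 1) := hmono hkN hkN' (Nat.lt_succ_self k)
  have ha : -1 ≤ ξ k := h0 ▸ hmono.monotoneOn (by simp) hkN (Nat.zero_le k)
  have hb : ξ (k + 1) ≤ 1 := h1 ▸ hmono.monotoneOn hkN' (by simp) hkN'
  refine ⟨sub_pos.2 hab, fun y hy => ⟨by nlinarith [hy.1, hy.2], ?_⟩⟩
  have hN' : (0 : ℝ) < N := by exact_mod_cast hN
  refine _root_.gap_bounds (by positivity) (lglPoly_ode N) hab ha hb (hz k hkN) (hz (k + 1) hkN')
    (fun x hx hx0 => ?_) hy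
  obtain ⟨j, hj, rfl⟩ := hall x hx0
  have h2 := (hmono.lt_iff_lt hkN hj).1 hx.1
  have h3 := (hmono.lt_iff_lt hj hkN').1 hx.2
  omega

/-- Local uniform equivalence of LGL grids of comparable order: for `0 < c ≤ 1`
there are `0 < A ≤ B` depending only on `c` such that whenever `1 ≤ M`,
`c·N ≤ M ≤ N`, `0 ≤ k ≤ N-1`, `0 ≤ ℓ ≤ M-1` and `Δ_k^N ∩ Δ_ℓ^M ≠ ∅`, one has
`A ≤ |Δ_k^N|/|Δ_ℓ^M| ≤ B`. -/
theorem lgl_local_uniform_equivalence (c : ℝ) (hc0 : 0 < c) (hc1 : c ≤ 1) :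
    ∃ A B : ℝ, 0 < A ∧ A ≤ B ∧
      ∀ M N : ℕ, ∀ ξN ξM : ℕ → ℝ, 1 ≤ M → c * (N : ℝ) ≤ (M : ℝ) → M ≤ N →
        IsLGLNodes N ξN → IsLGLNodes M ξM →
        ∀ k ℓ : ℕ, k ≤ N - 1 → ℓ ≤ M - 1 →
          (Set.Icc (ξN k) (ξN (k + 1)) ∩ Set.Icc (ξM ℓ) (ξM (ℓ + 1))).Nonempty →
          A ≤ (ξN (k + 1) - ξN k) / (ξM (ℓ + 1) - ξM ℓ) ∧
          (ξN (k + 1) - ξN k) / (ξM (ℓ + 1) - ξM ℓ) ≤ B := by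
  refine ⟨c ^ 2 / (6 * Real.pi ^ 2), 6 * Real.pi ^ 2, by positivity, ?_, ?_⟩
  · have hpi : 1 ≤ Real.pi ^ 2 := one_le_pow₀ (by linarith [Real.pi_gt_three])
    rw [div_le_iff₀ (by positivity)]
    nlinarith
  intro M N ξN ξM hM hcN hMN hξN hξM k ℓ hk hℓ ⟨y, hyN, hyM⟩
  obtain ⟨hdN, hN⟩ := hξN.gap_bounds (hM.trans hMN) hk
  obtain ⟨hdM, hM'⟩ := hξM.gap_bounds hM hℓ
  obtain ⟨hy, hN1, hN2⟩ := hN y hyN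
  obtain ⟨-, hM1, hM2⟩ := hM' y hyM
  have hMpos : (0 : ℝ) < M := by exact_mod_cast hM
  have hMN' : (M : ℝ) ≤ N := by exact_mod_cast hMN
  have hNpos : (0 : ℝ) < N := hMpos.trans_le hMN'
  have hlamM : (0 : ℝ) < M * (M + 1) := by positivity
  have hlamN : (0 : ℝ) < N * (N + 1) := by positivity
  have hle : (M * (M + 1) : ℝ) ≤ N * (N + 1) := by gcongr
  have hge : c ^ 2 * (N * (N + 1)) ≤ (M * (M + 1) : ℝ) := by
    calc c ^ 2 * (N * (N + 1)) = (c * N) * (c * N + c) := by ring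
      _ ≤ M * (M + 1) := by gcongr
  generalize (M * (M + 1) : ℝ) = lamM at *
  generalize (N * (N + 1) : ℝ) = lamN at *
  have hE1 : (1 - y ^ 2) / lamN + 1 / lamN ^ 2 ≤ (1 - y ^ 2) / lamM + 1 / lamM ^ 2 := by
    gcongr
  have hE2 : c ^ 4 * ((1 - y ^ 2) / lamM + 1 / lamM ^ 2) ≤
      (1 - y ^ 2) / lamN + 1 / lamN ^ 2 := by
    have hinv : c ^ 2 / lamM ≤ 1 / lamN := by
      rw [div_le_div_iff₀ hlamM hlamN]
      linarith
    have hc2 : c ^ 2 ≤ 1 := pow_le_one₀ hc0.le hc1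
    calc c ^ 4 * ((1 - y ^ 2) / lamM + 1 / lamM ^ 2)
        = c ^ 2 * ((1 - y ^ 2) * (c ^ 2 / lamM)) + (c ^ 2 / lamM) ^ 2 := by ring
      _ ≤ 1 * ((1 - y ^ 2) * (1 / lamN)) + (1 / lamN) ^ 2 := by gcongr
      _ = (1 - y ^ 2) / lamN + 1 / lamN ^ 2 := by ring
  set EN := (1 - y ^ 2) / lamN + 1 / lamN ^ 2
  set EM := (1 - y ^ 2) / lamM + 1 / lamM ^ 2
  set dN := ξN (k + 1) - ξN k
  set dM := ξM (ℓ + 1) - ξM ℓ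
  constructor
  · rw [div_le_div_iff₀ (by positivity) hdM]
    refine (sq_le_sq₀ (by positivity) (by positivity)).1 ?_
    calc (c ^ 2 * dM) ^ 2 = c ^ 4 * dM ^ 2 := by ring
      _ ≤ c ^ 4 * (4 * Real.pi ^ 4 * EM) := by gcongr
      _ = 4 * Real.pi ^ 4 * (c ^ 4 * EM) := by ring
      _ ≤ 4 * Real.pi ^ 4 * (9 * dN ^ 2) :=
        mul_le_mul_of_nonneg_left (hE2.trans hN1) (by positivity)
      _ = (dN * (6 * Real.pi ^ 2)) ^ 2 := by ring
  · rw [div_le_iff₀ hdM]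
    refine (sq_le_sq₀ (by positivity) (by positivity)).1 ?_
    calc dN ^ 2 ≤ 4 * Real.pi ^ 4 * EN := hN2
      _ ≤ 4 * Real.pi ^ 4 * (9 * dM ^ 2) :=
        mul_le_mul_of_nonneg_left (hE1.trans hM1) (by positivity)
      _ = (6 * Real.pi ^ 2 * dM) ^ 2 := by ring
end

section
/- Local uniform equivalence of the dyadic output grid with the input grid: let G be a grid on [a,b] that is locally quasi-uniform with constant C_g, let α, β > 0, and let P₀ be a dyadic partition of [a,b] such that every D ∈ P₀ with D ≠ [a,b] has parent D̂ satisfying |D̂| > β·m(D̂,G). If P is an α-output for (G,P₀), then for every D ∈ P and every Δ ∈ P(G) with Δ ∩ D ≠ ∅, one has 1/α ≤ |Δ|/|D| ≤ 2C_g/min{α, β, 1}. -/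
/-- The standard dyadic subinterval of `[a,b]` of level `p.1` and index `p.2`,
namely `[a + (b-a)·k·2^{-j}, a + (b-a)·(k+1)·2^{-j}]` for `p = (j,k)`. -/
def dInt (a b : ℝ) (p : ℕ × ℕ) : Set ℝ :=
  Set.Icc (a + (b - a) * p.2 / 2 ^ p.1) (a + (b - a) * (p.2 + 1) / 2 ^ p.1)

/-- The length `(b-a)·2^{-j}` of a standard dyadic subinterval of level `p.1`. -/
noncomputable def dLen (a b : ℝ) (p : ℕ × ℕ) : ℝ := (b - a) / 2 ^ p.1

/-- The parent `(j-1, k/2)` of the dyadic interval indexed by `p = (j,k)`. -/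
def dParent (p : ℕ × ℕ) : ℕ × ℕ := (p.1 - 1, p.2 / 2)

/-- A dyadic partition of `[a,b]`: a finite collection of standard dyadic
subintervals (encoded by their level/index pairs) with pairwise disjoint
interiors, whose union is `[a,b]`. -/
structure DyadicPartition (a b : ℝ) where
  ps : Finset (ℕ × ℕ)
  valid : ∀ p ∈ ps, p.2 < 2 ^ p.1
  cover : (⋃ p ∈ ps, dInt a b p) = Set.Icc a b
  disj : ∀ p ∈ ps, ∀ q ∈ ps, p ≠ q →
    interior (dInt a b p) ∩ interior (dInt a b q) = ∅

/-- The dyadic grid associated with a dyadic partition: the set of endpoints of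
its intervals. -/
def dGridSet {a b : ℝ} (P : DyadicPartition a b) : Set ℝ :=
  ⋃ p ∈ P.ps, ({a + (b - a) * p.2 / 2 ^ p.1, a + (b - a) * (p.2 + 1) / 2 ^ p.1} : Set ℝ)

/-- A grid on `[a,b]`: a finite strictly increasing sequence
`a = x 0 < x 1 < ⋯ < x M = b`. -/
structure Grid (a b : ℝ) where
  M : ℕ
  M_pos : 0 < M
  x : ℕ → ℝ
  mono : StrictMonoOn x (Set.Iic M)
  left : x 0 = a
  right : x M = b

/-- The `i`-th interval `[x i, x (i+1)]` of the partition induced by a grid. -/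
def Grid.interval {a b : ℝ} (G : Grid a b) (i : ℕ) : Set ℝ :=
  Set.Icc (G.x i) (G.x (i + 1))

/-- `m(I,G)`: the minimum length of a grid interval of `G` intersecting `I`. -/
noncomputable def Grid.gmin {a b : ℝ} (G : Grid a b) (I : Set ℝ) : ℝ :=
  sInf {d : ℝ | ∃ i < G.M, (G.interval i ∩ I).Nonempty ∧ d = G.x (i + 1) - G.x i}

/-- `P` is an α-output of the algorithm `DyadicGrid(G, P₀, α)`:
(a) every interval of `P` is contained in some interval of `P₀`;
(b) every interval `D` of `P` satisfies `|D| ≤ α·m(D,G)`;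
(c) every interval `D` of `P` not in `P₀` has a parent `D̂` with
    `|D̂| > α·m(D̂,G)`. -/
def IsAlphaOutput {a b : ℝ} (G : Grid a b) (P₀ P : DyadicPartition a b)
    (α : ℝ) : Prop :=
  (∀ p ∈ P.ps, ∃ q ∈ P₀.ps, dInt a b p ⊆ dInt a b q) ∧
  (∀ p ∈ P.ps, dLen a b p ≤ α * G.gmin (dInt a b p)) ∧
  (∀ p ∈ P.ps, p ∉ P₀.ps →
    1 ≤ p.1 ∧ dLen a b (dParent p) > α * G.gmin (dInt a b (dParent p)))

/-- A grid is symmetric if `x i + x (M-i) = a + b` for all `0 ≤ i ≤ M`. -/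
def Grid.Symmetric {a b : ℝ} (G : Grid a b) : Prop :=
  ∀ i ≤ G.M, G.x i + G.x (G.M - i) = a + b

/-- A grid is monotonic if for any two neighboring intervals contained in the
left half `[a, (a+b)/2]`, the left one is at most as long as the right one. -/
def Grid.Monotonic {a b : ℝ} (G : Grid a b) : Prop :=
  ∀ i : ℕ, i + 1 < G.M →
    G.interval i ∪ G.interval (i + 1) ⊆ Set.Icc a ((a + b) / 2) →
    G.x (i + 1) - G.x i ≤ G.x (i + 2) - G.x (i + 1)

/-- A grid is locally quasi-uniform with constant `C` if any two intersecting
intervals of its induced partition have length ratio between `C⁻¹` and `C`. -/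
def Grid.QuasiUniform {a b : ℝ} (G : Grid a b) (C : ℝ) : Prop :=
  ∀ i < G.M, ∀ j < G.M, (G.interval i ∩ G.interval j).Nonempty →
    C⁻¹ ≤ (G.x (i + 1) - G.x i) / (G.x (j + 1) - G.x j) ∧
    (G.x (i + 1) - G.x i) / (G.x (j + 1) - G.x j) ≤ C

/-- The dyadic grid associated with `P` is symmetric (around the midpoint of
`[a,b]`). -/
def DyadicPartition.SymmetricGrid {a b : ℝ} (P : DyadicPartition a b) : Prop :=
  ∀ x ∈ dGridSet P, a + b - x ∈ dGridSet P

/-- The partition `P` is monotonic: for any two of its intervals contained in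
the left half `[a, (a+b)/2]`, with the second the right neighbor of the first,
the left one is at most as long as the right one. -/
def DyadicPartition.Monotonic {a b : ℝ} (P : DyadicPartition a b) : Prop :=
  ∀ p ∈ P.ps, ∀ q ∈ P.ps,
    dInt a b p ∪ dInt a b q ⊆ Set.Icc a ((a + b) / 2) →
    a + (b - a) * (p.2 + 1) / 2 ^ p.1 = a + (b - a) * q.2 / 2 ^ q.1 →
    dLen a b p ≤ dLen a b q

theorem Grid.length_pos {a b : ℝ} (G : Grid a b) {i : ℕ} (hi : i < G.M) :
    0 < G.x (i + 1) - G.x i :=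
  sub_pos.2 (G.mono (Set.mem_Iic.2 hi.le) (Set.mem_Iic.2 hi) (Nat.lt_succ_self i))

theorem Grid.x_le {a b : ℝ} (G : Grid a b) {i j : ℕ} (hij : i ≤ j) (hj : j ≤ G.M) :
    G.x i ≤ G.x j :=
  G.mono.monotoneOn (Set.mem_Iic.2 (hij.trans hj)) (Set.mem_Iic.2 hj) hij

theorem Grid.gmin_le {a b : ℝ} (G : Grid a b) {I : Set ℝ} {i : ℕ} (hi : i < G.M)
    (h : (G.interval i ∩ I).Nonempty) : G.gmin I ≤ G.x (i + 1) - G.x i := by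
  refine csInf_le ⟨0, ?_⟩ ⟨i, hi, h, rfl⟩
  rintro d ⟨j, hj, -, rfl⟩
  exact (G.length_pos hj).le

theorem Grid.exists_length_lt_of_gmin_lt {a b : ℝ} (G : Grid a b) {I : Set ℝ} {i : ℕ} {t : ℝ}
    (hi : i < G.M) (h : (G.interval i ∩ I).Nonempty) (ht : G.gmin I < t) :
    ∃ j < G.M, (G.interval j ∩ I).Nonempty ∧ G.x (j + 1) - G.x j < t := by
  obtain ⟨d, ⟨j, hj, hne, rfl⟩, hd⟩ := exists_lt_of_csInf_lt (s := {d : ℝ | ∃ i < G.M,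
    (G.interval i ∩ I).Nonempty ∧ d = G.x (i + 1) - G.x i}) ⟨_, i, hi, h, rfl⟩ ht
  exact ⟨j, hj, hne, hd⟩

theorem Grid.QuasiUniform.length_le {a b C : ℝ} {G : Grid a b} (hG : G.QuasiUniform C)
    {i j : ℕ} (hi : i < G.M) (hj : j < G.M) (h : (G.interval i ∩ G.interval j).Nonempty) :
    G.x (i + 1) - G.x i ≤ C * (G.x (j + 1) - G.x j) :=
  (div_le_iff₀ (G.length_pos hj)).1 (hG i hi j hj h).2

theorem Grid.QuasiUniform.one_le {a b C : ℝ} {G : Grid a b} (hG : G.QuasiUniform C) :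
    1 ≤ C := by
  have h := G.length_pos G.M_pos
  have := (hG 0 G.M_pos 0 G.M_pos ⟨G.x 0, ⟨le_rfl, by linarith⟩, le_rfl, by linarith⟩).2
  rwa [div_self h.ne'] at this

/-- Consecutive grid intervals meet. -/
theorem Grid.interval_inter_succ_nonempty {a b : ℝ} (G : Grid a b) {i : ℕ} (hi : i + 1 < G.M) :
    (G.interval i ∩ G.interval (i + 1)).Nonempty :=
  ⟨G.x (i + 1), ⟨G.x_le (Nat.le_succ i) hi.le, le_rfl⟩, le_rfl, G.x_le (Nat.le_succ _) hi⟩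

/-- If two grid intervals meet `[l, r]`, then the first one is at most `C` times as long as `s`,
whenever `s` dominates both the second one and `[l, r]`. -/
theorem Grid.QuasiUniform.length_le_of_inter_Icc {a b C l r s : ℝ} {G : Grid a b}
    (hG : G.QuasiUniform C) {i j : ℕ} (hi : i < G.M) (hj : j < G.M)
    (hil : (G.interval i ∩ Set.Icc l r).Nonempty) (hjl : (G.interval j ∩ Set.Icc l r).Nonempty)
    (hs : G.x (j + 1) - G.x j ≤ s) (hrs : r - l ≤ s) :
    G.x (i + 1) - G.x i ≤ C * s := by
  have hC : 0 ≤ C := zero_le_one.trans hG.one_le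
  obtain ⟨u, ⟨hu₁, hu₂⟩, hu₃, hu₄⟩ := hil
  obtain ⟨v, ⟨hv₁, hv₂⟩, hv₃, hv₄⟩ := hjl
  have key : ∃ k < G.M, (G.interval i ∩ G.interval k).Nonempty ∧ G.x (k + 1) - G.x k ≤ s := by
    rcases lt_trichotomy i j with hij | rfl | hij
    · have hi' : i + 1 < G.M := by omega
      refine ⟨i + 1, hi', G.interval_inter_succ_nonempty hi', ?_⟩
      rcases hij.nat_succ_le.eq_or_lt with rfl | hlt
      · exact hs
      · have := G.x_le (show i + 1 + 1 ≤ j from hlt) hj.le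
        linarith
    · exact ⟨i, hi, ⟨u, ⟨hu₁, hu₂⟩, hu₁, hu₂⟩, hs⟩
    · obtain ⟨k, rfl⟩ : ∃ k, i = k + 1 := ⟨i - 1, by omega⟩
      refine ⟨k, by omega, ?_, ?_⟩
      · rw [Set.inter_comm]
        exact G.interval_inter_succ_nonempty hi
      · rcases (Nat.lt_succ_iff.1 hij).eq_or_lt with rfl | hlt
        · exact hs
        · have := G.x_le (show j + 1 ≤ k from hlt) (by omega)
          linarith
  obtain ⟨k, hk, hik, hks⟩ := key
  exact (hG.length_le hi hk hik).trans (mul_le_mul_of_nonneg_left hks hC)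

theorem dLen_pos {a b : ℝ} (hab : a < b) (p : ℕ × ℕ) : 0 < dLen a b p :=
  div_pos (sub_pos.2 hab) (by positivity)

theorem dLen_dParent {a b : ℝ} {p : ℕ × ℕ} (hp : 1 ≤ p.1) :
    dLen a b (dParent p) = 2 * dLen a b p := by
  obtain ⟨j, k⟩ := p
  obtain ⟨n, rfl⟩ : ∃ n, j = n + 1 := ⟨j - 1, by simp at hp; omega⟩
  simp only [dLen, dParent, Nat.add_sub_cancel, pow_succ]
  field_simp

theorem dInt_subset_dInt_dParent {a b : ℝ} (hab : a < b) {p : ℕ × ℕ} (hp : 1 ≤ p.1) :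
    dInt a b p ⊆ dInt a b (dParent p) := by
  obtain ⟨j, k⟩ := p
  obtain ⟨n, rfl⟩ : ∃ n, j = n + 1 := ⟨j - 1, by simp at hp; omega⟩
  have hba : 0 < b - a := sub_pos.2 hab
  have h₁ : (2 : ℝ) * (k / 2 : ℕ) ≤ k := by exact_mod_cast (by omega : 2 * (k / 2) ≤ k)
  have h₂ : (k : ℝ) + 1 ≤ 2 * ((k / 2 : ℕ) + 1) := by
    exact_mod_cast (by omega : k + 1 ≤ 2 * (k / 2 + 1))
  have hpow : (0 : ℝ) < 2 ^ n := by positivity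
  simp only [dInt, dParent, Nat.add_sub_cancel, pow_succ]
  refine Set.Icc_subset_Icc ?_ ?_ <;> refine add_le_add_right ?_ a <;>
    rw [div_le_div_iff₀ (by positivity) (by positivity)]
  · have := mul_le_mul_of_nonneg_left h₁ (mul_pos hba hpow).le
    linarith
  · have := mul_le_mul_of_nonneg_left h₂ (mul_pos hba hpow).le
    linarith

theorem dInt_length (a b : ℝ) (p : ℕ × ℕ) :
    a + (b - a) * (p.2 + 1) / 2 ^ p.1 - (a + (b - a) * p.2 / 2 ^ p.1) = dLen a b p := by
  unfold dLen
  ring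

/-- Local uniform equivalence of the dyadic output grid with the input grid:
if `G` is locally quasi-uniform with constant `C_g`, the parents of the
non-root intervals of the initial dyadic partition `P₀` satisfy
`|D̂| > β·m(D̂,G)`, and `P` is an α-output for `(G,P₀)`, then every `D ∈ P` and
every `Δ ∈ P(G)` with `Δ ∩ D ≠ ∅` satisfy
`1/α ≤ |Δ|/|D| ≤ 2·C_g / min {α, β, 1}`. -/
theorem dyadic_output_locally_uniformly_equivalent {a b : ℝ} (hab : a < b)
    (G : Grid a b) (Cg : ℝ) (hG : G.QuasiUniform Cg)
    (α β : ℝ) (hα : 0 < α) (hβ : 0 < β)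
    (P₀ P : DyadicPartition a b)
    (hP₀ : ∀ p ∈ P₀.ps, dInt a b p ≠ Set.Icc a b →
      dLen a b (dParent p) > β * G.gmin (dInt a b (dParent p)))
    (hP : IsAlphaOutput G P₀ P α) :
    ∀ p ∈ P.ps, ∀ i < G.M, (G.interval i ∩ dInt a b p).Nonempty →
      1 / α ≤ (G.x (i + 1) - G.x i) / dLen a b p ∧
      (G.x (i + 1) - G.x i) / dLen a b p ≤ 2 * Cg / min α (min β 1) := by
  obtain ⟨hsub, hle, hpar⟩ := hP
  intro p hp i hi hne
  have hD := dLen_pos hab p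
  have hΔ := G.length_pos hi
  have hC := hG.one_le
  set γ := min α (min β 1) with hγ
  have hγ0 : 0 < γ := lt_min hα (lt_min hβ one_pos)
  have hγ1 : γ ≤ 1 := (min_le_right _ _).trans (min_le_right _ _)
  refine ⟨?_, ?_⟩
  · rw [div_le_div_iff₀ hα hD, one_mul, mul_comm]
    exact (hle p hp).trans (mul_le_mul_of_nonneg_left (G.gmin_le hi hne) hα.le)
  have main : ∀ δ, γ ≤ δ → 1 ≤ p.1 →
      dLen a b (dParent p) > δ * G.gmin (dInt a b (dParent p)) →
      (G.x (i + 1) - G.x i) / dLen a b p ≤ 2 * Cg / γ := by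
    intro δ hδ hp1 hlt
    have hδ0 : 0 < δ := hγ0.trans_le hδ
    have hlen := dLen_dParent (a := a) (b := b) hp1
    have hne' := hne.mono (Set.inter_subset_inter_right _ (dInt_subset_dInt_dParent hab hp1))
    obtain ⟨j, hj, hjne, hjlt⟩ := G.exists_length_lt_of_gmin_lt hi hne'
      ((lt_div_iff₀' hδ0).2 hlt)
    have hs : G.x (j + 1) - G.x j ≤ 2 * dLen a b p / γ := by
      rw [hlen] at hjlt
      exact hjlt.le.trans (by gcongr)
    have hrs : dLen a b (dParent p) ≤ 2 * dLen a b p / γ := by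
      rw [hlen]
      exact le_div_self (by positivity) hγ0 hγ1
    rw [← dInt_length] at hrs
    have := hG.length_le_of_inter_Icc hi hj hne' hjne hs hrs
    rw [div_le_iff₀ hD]
    calc _ ≤ _ := this
      _ = _ := by ring
  by_cases hp0 : p ∈ P₀.ps
  · by_cases hroot : dInt a b p = Set.Icc a b
    · have hl : b - a = dLen a b p := by
        have hle' : a + (b - a) * p.2 / 2 ^ p.1 ≤ a + (b - a) * (p.2 + 1) / 2 ^ p.1 := by
          have := dInt_length a b p
          linarith
        obtain ⟨h₁, h₂⟩ := (Set.Icc_eq_Icc_iff hle').1 hroot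
        rw [← dInt_length, h₁, h₂]
      have h₀ := G.x_le (Nat.zero_le i) hi.le
      have h₁ := G.x_le (show i + 1 ≤ G.M from hi) le_rfl
      rw [G.left] at h₀
      rw [G.right] at h₁
      rw [div_le_div_iff₀ hD hγ0]
      have hx : G.x (i + 1) - G.x i ≤ dLen a b p := by linarith
      nlinarith [mul_le_mul_of_nonneg_left hγ1 hΔ.le, mul_le_mul_of_nonneg_right hC hD.le]
    · have hp1 : 1 ≤ p.1 := by
        by_contra h
        have h₁ : p.1 = 0 := by omega
        have h₂ : p.2 = 0 := by
          have := P₀.valid p hp0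
          rw [h₁] at this
          omega
        exact hroot (by simp [dInt, h₁, h₂])
      exact main β ((min_le_right _ _).trans (min_le_left _ _)) hp1 (hP₀ p hp0 hroot)
  · obtain ⟨hp1, hlt⟩ := hpar p hp hp0
    exact main α (min_le_left _ _) hp1 hlt
end
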